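/- arXiv:2103.09997 — 2 statements merged into one kernel-verified Lean document; each statement's English description precedes it below -/
import Mathlib

section
/- For every 7-tuple (θ₀,…,θ₆) of points of T³ = S¹×S¹×S¹ one has |Θ(θ₀,…,θ₆)| ≤ 11/45. -/
open scoped BigOperators
open scoped Classical

noncomputable section

instance : Fact ((0:ℝ) < 1) := ⟨one_pos⟩

/-- The circle `ℝ/ℤ` with its standard circular order. -/
abbrev S1 : Type := AddCircle (1 : ℝ)

/-- The 3-torus `S¹ × S¹ × S¹`. -/
abbrev T3 : Type := S1 × S1 × S1

/-- The orientation cocycle on the circle: `1` if `(a,b,c)` are pairwise distinct and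
positively oriented, `-1` if pairwise distinct and negatively oriented, `0` otherwise. -/
noncomputable def OrS1 (a b c : S1) : ℝ :=
  if sbtw a b c then 1 else if sbtw c b a then -1 else 0

/-- The cocycle `Θ` on `(T³)⁷`. -/
noncomputable def Theta (θ : Fin 7 → T3) : ℝ :=
  (1 / (Nat.factorial 7 : ℝ)) * ∑ σ : Equiv.Perm (Fin 7),
    ((Equiv.Perm.sign σ : ℤ) : ℝ) *
      (OrS1 (θ (σ 0)).1 (θ (σ 1)).1 (θ (σ 2)).1 *
       OrS1 (θ (σ 2)).2.1 (θ (σ 3)).2.1 (θ (σ 4)).2.1 *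
       OrS1 (θ (σ 4)).2.2 (θ (σ 5)).2.2 (θ (σ 6)).2.2)

/-- `1`, `-1` or `0` according to whether `a < b`, `b < a` or neither. -/
def orderSign {α : Type*} [LT α] [DecidableLT α] (a b : α) : ℤ :=
  if a < b then 1 else if b < a then -1 else 0

/-- The sum of `B a b` over all pairs of entries with `a` before `b`. -/
def pairSum {α : Type*} (B : α → α → ℤ) : List α → ℤ
  | [] => 0
  | a :: l => (l.map (B a)).sum + pairSum B l

/-- A branch-and-bound test that `pairSum B m ≤ c` for every rearrangement `m` of `l`. -/
def pairSumBounded {α : Type*} [DecidableEq α] (B : α → α → ℤ) : ℕ → ℤ → List α → Bool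
  | 0, c, l => decide (pairSum (fun a b => |B a b|) l ≤ c)
  | n + 1, c, l => decide (pairSum (fun a b => |B a b|) l ≤ c) ||
      (!l.isEmpty && l.all fun a =>
        pairSumBounded B n (c - ((l.erase a).map (B a)).sum) (l.erase a))

/-- The polarised Pfaffian on four ordered points of `s` and the constant form `1`. -/
def mixedPfaffian {α : Type*} (s : α → α → ℤ) : List α → ℤ
  | [a, b, c, d] => s a b + s c d - (s a c + s b d) + (s a d + s b c)
  | _ => 0

/-- The signed complementary coefficient of the pair `i, j` in `{0, …, 5}`. -/
def pairCoeff (s : ℕ → ℕ → ℤ) (i j : ℕ) : ℤ :=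
  orderSign i j * ((-1) ^ (i + j + 1) * mixedPfaffian s (((List.range 6).erase i).erase j))

/-- The order signs of the entries of a list, as a function of their positions. -/
def listSign (p : List ℕ) (i j : ℕ) : ℤ := orderSign (p.getD i 0) (p.getD j 0)

theorem pairSumBounded_permutations :
    ∀ p ∈ (List.range 6).permutations',
      pairSumBounded (pairCoeff (listSign p)) 6 22 (List.range 6) = true := by
  decide +kernel

theorem pairSum_le_pairSum_abs {α : Type*} (B : α → α → ℤ) (l : List α) :
    pairSum B l ≤ pairSum (fun a b => |B a b|) l := by
  induction l with
  | nil => simp [pairSum]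
  | cons a l ih => exact add_le_add (List.sum_le_sum fun b _ => le_abs_self _) ih

theorem pairSum_perm {α : Type*} {B : α → α → ℤ} (hB : ∀ a b, B a b = B b a) {l l' : List α}
    (h : l.Perm l') : pairSum B l = pairSum B l' := by
  induction h with
  | nil => rfl
  | cons a h ih => simp only [pairSum, ih, (h.map (B a)).sum_eq]
  | swap a b l =>
    simp only [pairSum, List.map_cons, List.sum_cons, hB b a]
    ring
  | trans _ _ ih₁ ih₂ => exact ih₁.trans ih₂

theorem pairSum_le_of_pairSumBounded {α : Type*} [DecidableEq α] {B : α → α → ℤ}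
    (hB : ∀ a b, |B a b| = |B b a|) (n : ℕ) {c : ℤ} {l l' : List α}
    (h : pairSumBounded B n c l = true) (hl : l'.Perm l) : pairSum B l' ≤ c := by
  have key (hc : pairSum (fun a b => |B a b|) l ≤ c) : pairSum B l' ≤ c :=
    (pairSum_le_pairSum_abs B l').trans ((pairSum_perm hB hl).trans_le hc)
  induction n generalizing c l l' with
  | zero => exact key (by simpa [pairSumBounded] using h)
  | succ n ih =>
    simp only [pairSumBounded, Bool.or_eq_true, decide_eq_true_eq, Bool.and_eq_true,
      List.all_eq_true] at h
    rcases h with h | ⟨hne, h⟩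
    · exact key h
    · cases l' with
      | nil => simp [hl.nil_eq.symm] at hne
      | cons a t =>
        have ht : t.Perm (l.erase a) := by simpa using hl.erase a
        have := ih (h a (hl.subset (by simp))) ht fun hc =>
          (pairSum_le_pairSum_abs B t).trans ((pairSum_perm hB ht).trans_le hc)
        rw [pairSum, (ht.map (B a)).sum_eq]
        linarith

section OrderSign

variable {α : Type*} [LinearOrder α]

theorem orderSign_self (a : α) : orderSign a a = 0 := by simp [orderSign]

theorem orderSign_swap (a b : α) : orderSign b a = -orderSign a b := by
  rcases lt_trichotomy a b with h | h | h <;> simp [orderSign, h, h.not_gt]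

end OrderSign

theorem abs_pairCoeff_comm (s : ℕ → ℕ → ℤ) (i j : ℕ) :
    |pairCoeff s i j| = |pairCoeff s j i| := by
  rw [pairCoeff, pairCoeff, orderSign_swap j i, List.erase_comm, add_comm i j, neg_mul, abs_neg]

theorem pairSum_ofFn_six {α : Type*} (B : α → α → ℤ) (f : Fin 6 → α)
    (hB : ∀ a b, B b a = -B a b) :
    2 * pairSum B (List.ofFn f) = ∑ i, ∑ j, orderSign i j * B (f i) (f j) := by
  simp only [pairSum, List.ofFn_succ, Fin.sum_univ_six, List.map_cons, List.sum_cons]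
  simp [pairSum, orderSign]
  linarith [hB (f 0) (f 1), hB (f 0) (f 2), hB (f 0) (f 3), hB (f 0) (f 4), hB (f 0) (f 5),
    hB (f 1) (f 2), hB (f 1) (f 3), hB (f 1) (f 4), hB (f 1) (f 5), hB (f 2) (f 3),
    hB (f 2) (f 4), hB (f 2) (f 5), hB (f 3) (f 4), hB (f 3) (f 5), hB (f 4) (f 5)]

theorem perm_ofFn_range (π : Equiv.Perm (Fin 6)) :
    (List.ofFn fun i => (π i : ℕ)).Perm (List.range 6) := by
  have h : List.range 6 = List.ofFn fun i : Fin 6 => (i : ℕ) := by decide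
  rw [h]
  exact π.ofFn_comp_perm _

theorem sum_orderSign_mul_pairCoeff_le (π₂ π₃ : Equiv.Perm (Fin 6)) :
    ∑ i, ∑ j, orderSign (π₂ i) (π₂ j) *
      pairCoeff (listSign (List.ofFn fun i => (π₃ i : ℕ))) i j ≤ 44 := by
  set B := pairCoeff (listSign (List.ofFn fun i => (π₃ i : ℕ))) with hBdef
  have hB : ∀ a b, B b a = -B a b := fun a b => by
    rw [hBdef, pairCoeff, pairCoeff, orderSign_swap a b, List.erase_comm, add_comm b a, neg_mul]
  have h := pairSum_le_of_pairSumBounded (abs_pairCoeff_comm _) 6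
    (pairSumBounded_permutations _ (List.mem_permutations'.2 (perm_ofFn_range π₃)))
    (perm_ofFn_range π₂.symm)
  have h' := pairSum_ofFn_six B (fun i => (π₂.symm i : ℕ)) hB
  rw [← Equiv.sum_comp π₂] at h'
  simp_rw [← Equiv.sum_comp π₂ (fun j => orderSign (π₂ _) j * _)] at h'
  simp only [Equiv.symm_apply_apply] at h'
  rw [← h']
  linarith

/-- The signed sum of `G` over all rearrangements of the tuple `x`. -/
def altSum {α : Type*} {n : ℕ} (x : Fin n → α) (G : (Fin n → α) → ℝ) : ℝ :=
  ∑ σ : Equiv.Perm (Fin n), ((Equiv.Perm.sign σ : ℤ) : ℝ) * G (x ∘ σ)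

section AltSum

variable {α β : Type*} {n : ℕ}

theorem altSum_add (x : Fin n → α) (G H : (Fin n → α) → ℝ) :
    altSum x (fun y => G y + H y) = altSum x G + altSum x H := by
  simp only [altSum, mul_add, Finset.sum_add_distrib]

theorem altSum_const_mul (x : Fin n → α) (c : ℝ) (G : (Fin n → α) → ℝ) :
    altSum x (fun y => c * G y) = c * altSum x G := by
  simp only [altSum, Finset.mul_sum]
  exact Finset.sum_congr rfl fun σ _ => by ring

theorem altSum_neg (x : Fin n → α) (G : (Fin n → α) → ℝ) :
    altSum x (fun y => -G y) = -altSum x G := by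
  simpa using altSum_const_mul x (-1) G

theorem altSum_comp_left (x : Fin n → α) (f : α → β) (G : (Fin n → β) → ℝ) :
    altSum x (fun y => G (f ∘ y)) = altSum (f ∘ x) G := rfl

theorem altSum_comp_perm (x : Fin n → α) (τ : Equiv.Perm (Fin n)) (G : (Fin n → α) → ℝ) :
    altSum x (fun y => G (y ∘ τ)) = ((Equiv.Perm.sign τ : ℤ) : ℝ) * altSum x G := by
  rw [altSum, altSum, Finset.mul_sum, ← Equiv.sum_comp (Equiv.mulRight τ⁻¹)]
  refine Finset.sum_congr rfl fun σ _ => ?_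
  have h : (x ∘ ⇑(σ * τ⁻¹)) ∘ ⇑τ = x ∘ σ := by ext i; simp
  simp only [Equiv.coe_mulRight, h, Equiv.Perm.sign_mul, Equiv.Perm.sign_inv]
  push_cast
  ring

theorem altSum_perm_comp (x : Fin n → α) (τ : Equiv.Perm (Fin n)) (G : (Fin n → α) → ℝ) :
    altSum (x ∘ τ) G = ((Equiv.Perm.sign τ : ℤ) : ℝ) * altSum x G := by
  rw [altSum, altSum, Finset.mul_sum, ← Equiv.sum_comp (Equiv.mulLeft τ⁻¹)]
  refine Finset.sum_congr rfl fun σ _ => ?_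
  have h : (x ∘ τ) ∘ ⇑(τ⁻¹ * σ) = x ∘ σ := by ext i; simp
  simp only [Equiv.coe_mulLeft, h, Equiv.Perm.sign_mul, Equiv.Perm.sign_inv]
  push_cast
  ring

theorem altSum_eq_zero_of_comp_swap (x : Fin n → α) {i j : Fin n} (hij : i ≠ j)
    {G : (Fin n → α) → ℝ} (hG : ∀ y, G (y ∘ Equiv.swap i j) = G y) : altSum x G = 0 := by
  have h := altSum_comp_perm x (Equiv.swap i j) G
  simp only [hG, Equiv.Perm.sign_swap hij] at h
  push_cast at h
  linarith

theorem altSum_succ (x : Fin (n + 1) → α) (G : (Fin (n + 1) → α) → ℝ) :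
    altSum x G = ∑ p, (if p = 0 then 1 else -1) *
      altSum (fun i => x (Equiv.swap 0 p i.succ)) fun y => G (Matrix.vecCons (x p) y) := by
  rw [altSum, ← Equiv.sum_comp Equiv.Perm.decomposeFin.symm, Fintype.sum_prod_type]
  refine Finset.sum_congr rfl fun p _ => ?_
  rw [altSum, Finset.mul_sum]
  refine Finset.sum_congr rfl fun σ _ => ?_
  have h : x ∘ ⇑(Equiv.Perm.decomposeFin.symm (p, σ)) =
      Matrix.vecCons (x p) ((fun i => x (Equiv.swap 0 p i.succ)) ∘ σ) := by
    ext i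
    refine Fin.cases ?_ (fun i => ?_) i <;> simp
  rw [h, Equiv.Perm.decomposeFin.symm_sign]
  split_ifs <;> simp

end AltSum


section CocycleProduct

variable {α : Type*}

theorem altSum_cocycle_mul (x : Fin 7 → α) (s₁ s₂ s₃ : α → α → ℝ) :
    altSum x (fun y => (s₁ (y 0) (y 1) + s₁ (y 1) (y 2) + s₁ (y 2) (y 0)) *
      (s₂ (y 2) (y 3) + s₂ (y 3) (y 4) + s₂ (y 4) (y 2)) *
      (s₃ (y 4) (y 5) + s₃ (y 5) (y 6) + s₃ (y 6) (y 4))) =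
    7 * altSum x (fun y => s₁ (y 1) (y 2) * s₂ (y 3) (y 4) * s₃ (y 5) (y 6)) := by
  set M : (Fin 6 → Fin 7) → ℝ := fun v => altSum x fun y =>
    s₁ (y (v 0)) (y (v 1)) * s₂ (y (v 2)) (y (v 3)) * s₃ (y (v 4)) (y (v 5)) with hM
  have hzero (v : Fin 6 → Fin 7) (h : ∃ p q, p ≠ q ∧ ∀ k, v k ≠ p ∧ v k ≠ q) : M v = 0 := by
    obtain ⟨p, q, hpq, h⟩ := h
    refine altSum_eq_zero_of_comp_swap x hpq fun y => ?_
    simp only [Function.comp_apply, Equiv.swap_apply_of_ne_of_ne (h _).1 (h _).2]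
  have heven (τ : Equiv.Perm (Fin 7)) (hτ : Equiv.Perm.sign τ = 1) (v : Fin 6 → Fin 7)
      (hv : ∀ k, v k = τ k.succ) : M v = M Fin.succ := by
    have h := altSum_comp_perm x τ fun y =>
      s₁ (y 1) (y 2) * s₂ (y 3) (y 4) * s₃ (y 5) (y 6)
    simp only [hτ] at h
    simp only [hM, hv]
    simpa using h
  have hexp : altSum x (fun y => (s₁ (y 0) (y 1) + s₁ (y 1) (y 2) + s₁ (y 2) (y 0)) *
      (s₂ (y 2) (y 3) + s₂ (y 3) (y 4) + s₂ (y 4) (y 2)) *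
      (s₃ (y 4) (y 5) + s₃ (y 5) (y 6) + s₃ (y 6) (y 4))) =
      ∑ a : Fin 3, ∑ b : Fin 3, ∑ c : Fin 3, M
        ![(![0, 1, 2] : Fin 3 → Fin 7) a, (![1, 2, 0] : Fin 3 → Fin 7) a,
          (![2, 3, 4] : Fin 3 → Fin 7) b, (![3, 4, 2] : Fin 3 → Fin 7) b,
          (![4, 5, 6] : Fin 3 → Fin 7) c, (![5, 6, 4] : Fin 3 → Fin 7) c] := by
    simp only [Fin.sum_univ_three, hM, Matrix.cons_val, ← altSum_add]
    congr 1
    funext y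
    ring
  rw [hexp]
  simp only [Fin.sum_univ_three, Matrix.cons_val]
  rw [heven c[0, 6, 5, 4, 3, 2, 1] (by decide +kernel) ![0, 1, 2, 3, 4, 5] (by decide),
    heven c[0, 4, 3, 2, 1] (by decide +kernel) ![0, 1, 2, 3, 5, 6] (by decide),
    heven c[0, 5, 6, 4, 3, 2, 1] (by decide +kernel) ![0, 1, 2, 3, 6, 4] (by decide),
    heven c[0, 2, 1] (by decide +kernel) ![0, 1, 3, 4, 5, 6] (by decide),
    heven c[0, 3, 4, 2, 1] (by decide +kernel) ![0, 1, 4, 2, 5, 6] (by decide),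
    heven 1 (by decide +kernel) ![1, 2, 3, 4, 5, 6] (by decide),
    heven c[0, 1, 2] (by decide +kernel) ![2, 0, 3, 4, 5, 6] (by decide)]
  rw [hzero ![0, 1, 3, 4, 4, 5] (by decide), hzero ![0, 1, 3, 4, 6, 4] (by decide),
    hzero ![0, 1, 4, 2, 4, 5] (by decide), hzero ![0, 1, 4, 2, 6, 4] (by decide),
    hzero ![1, 2, 2, 3, 4, 5] (by decide), hzero ![1, 2, 2, 3, 5, 6] (by decide),
    hzero ![1, 2, 2, 3, 6, 4] (by decide), hzero ![1, 2, 3, 4, 4, 5] (by decide),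
    hzero ![1, 2, 3, 4, 6, 4] (by decide), hzero ![1, 2, 4, 2, 4, 5] (by decide),
    hzero ![1, 2, 4, 2, 5, 6] (by decide), hzero ![1, 2, 4, 2, 6, 4] (by decide),
    hzero ![2, 0, 2, 3, 4, 5] (by decide), hzero ![2, 0, 2, 3, 5, 6] (by decide),
    hzero ![2, 0, 2, 3, 6, 4] (by decide), hzero ![2, 0, 3, 4, 4, 5] (by decide),
    hzero ![2, 0, 3, 4, 6, 4] (by decide), hzero ![2, 0, 4, 2, 4, 5] (by decide),
    hzero ![2, 0, 4, 2, 5, 6] (by decide), hzero ![2, 0, 4, 2, 6, 4] (by decide)]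
  have h : M Fin.succ = altSum x (fun y => s₁ (y 1) (y 2) * s₂ (y 3) (y 4) * s₃ (y 5) (y 6)) := rfl
  rw [h]
  ring

theorem altSum_eq_tail (x : Fin 7 → α) {s₁ s₂ s₃ : α → α → ℝ}
    (h₁ : ∀ a, s₁ (x 0) a = 0 ∧ s₁ a (x 0) = 0) (h₂ : ∀ a, s₂ (x 0) a = 0 ∧ s₂ a (x 0) = 0)
    (h₃ : ∀ a, s₃ (x 0) a = 0 ∧ s₃ a (x 0) = 0) :
    altSum x (fun y => s₁ (y 1) (y 2) * s₂ (y 3) (y 4) * s₃ (y 5) (y 6)) =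
    altSum (Fin.tail x) (fun y => s₁ (y 0) (y 1) * s₂ (y 2) (y 3) * s₃ (y 4) (y 5)) := by
  rw [altSum_succ, Fin.sum_univ_succ, Finset.sum_eq_zero, add_zero]
  · simp [Equiv.swap_self, Fin.tail_def]
  · intro p _
    rw [altSum, Finset.sum_eq_zero, mul_zero]
    intro σ _
    have hx : ((fun i : Fin 6 => x (Equiv.swap 0 p.succ i.succ)) ∘ σ) (σ⁻¹ p) = x 0 := by simp
    generalize (fun i : Fin 6 => x (Equiv.swap 0 p.succ i.succ)) ∘ σ = y at hx ⊢
    generalize σ⁻¹ p = q at hx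
    simp only [Matrix.cons_val]
    fin_cases q <;> simp only [Fin.zero_eta, Fin.mk_one, Fin.reduceFinMk] at hx <;>
      simp [hx, h₁, h₂, h₃]

end CocycleProduct

theorem altSum_four {α : Type*} {s t : α → α → ℝ} (hs : ∀ a b, s b a = -s a b)
    (ht : ∀ a b, t b a = -t a b) (x : Fin 4 → α) :
    altSum x (fun y => s (y 0) (y 1) * t (y 2) (y 3)) =
      4 * (s (x 0) (x 1) * t (x 2) (x 3) - s (x 0) (x 2) * t (x 1) (x 3)
        + s (x 0) (x 3) * t (x 1) (x 2) + s (x 1) (x 2) * t (x 0) (x 3)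
        - s (x 1) (x 3) * t (x 0) (x 2) + s (x 2) (x 3) * t (x 0) (x 1)) := by
  simp only [altSum_succ, Fin.sum_univ_succ]
  simp [altSum, Equiv.swap_apply_def, Fin.ext_iff]
  rw [hs (x 0) (x 1), hs (x 0) (x 2), hs (x 0) (x 3), hs (x 1) (x 2), hs (x 1) (x 3),
    hs (x 2) (x 3), ht (x 0) (x 1), ht (x 0) (x 2), ht (x 0) (x 3), ht (x 1) (x 2),
    ht (x 1) (x 3), ht (x 2) (x 3)]
  ring

theorem altSum_six {s : Fin 6 → Fin 6 → ℤ} {t : ℕ → ℕ → ℤ} (hs : ∀ a b, s b a = -s a b)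
    (ht : ∀ a b, t b a = -t a b) :
    altSum (id : Fin 6 → Fin 6)
      (fun y => (orderSign (y 0) (y 1) : ℝ) * ((s (y 2) (y 3) : ℝ) * (t (y 4) (y 5) : ℝ))) =
      ((4 * ∑ i, ∑ j, s i j * pairCoeff t i j : ℤ) : ℝ) := by
  have hs' : ∀ a b, (s b a : ℝ) = -(s a b : ℝ) := fun a b => by rw [hs a b]; push_cast; rfl
  have ht' : ∀ a b : Fin 6, (t b a : ℝ) = -(t a b : ℝ) := fun a b => by rw [ht a b]; push_cast; rfl
  have key (a b : Fin 6) (x : Fin 4 → Fin 6) := altSum_const_mul x (orderSign a b : ℝ)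
    fun y => (s (y 0) (y 1) : ℝ) * (t (y 2) (y 3) : ℝ)
  simp only [altSum_four hs' ht'] at key
  rw [altSum_succ]
  simp only [altSum_succ (n := 4), Matrix.cons_val, key]
  have hr : List.range 6 = [0, 1, 2, 3, 4, 5] := rfl
  simp only [Fin.sum_univ_succ, pairCoeff, hr, id]
  simp [Equiv.swap_apply_def, Fin.ext_iff, orderSign, mixedPfaffian]
  simp only [hs 0 1, hs 0 2, hs 0 3, hs 0 4, hs 0 5, hs 1 2, hs 1 3, hs 1 4, hs 1 5, hs 2 3, hs 2 4,
    hs 2 5, hs 3 4, hs 3 5, hs 4 5, ht 0 1, ht 0 2, ht 0 3, ht 0 4, ht 1 2, ht 1 3, ht 1 4]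
  push_cast
  ring

theorem sbtw_coe_iff {x y z : ℝ} (hx : x ∈ Set.Ico (0 : ℝ) 1) (hy : y ∈ Set.Ico (0 : ℝ) 1)
    (hz : z ∈ Set.Ico (0 : ℝ) 1) :
    sbtw (x : S1) y z ↔ x < y ∧ y < z ∨ y < z ∧ z < x ∨ z < x ∧ x < y := by
  obtain ⟨hx0, hx1⟩ := hx
  obtain ⟨hy0, hy1⟩ := hy
  obtain ⟨hz0, hz1⟩ := hz
  have hIoc : toIocMod (one_pos : (0 : ℝ) < 1) x y = if x < y then y else y + 1 := by
    rw [toIocMod_eq_iff]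
    split_ifs with h
    · exact ⟨⟨h, by linarith⟩, 0, by simp⟩
    · exact ⟨⟨by linarith, by linarith⟩, -1, by simp⟩
  have hIco : toIcoMod (one_pos : (0 : ℝ) < 1) x z = if x ≤ z then z else z + 1 := by
    rw [toIcoMod_eq_iff]
    split_ifs with h
    · exact ⟨⟨h, by linarith⟩, 0, by simp⟩
    · exact ⟨⟨by linarith, by linarith⟩, -1, by simp⟩
  have h : sbtw (x : S1) y z ↔
      toIocMod (one_pos : (0 : ℝ) < 1) x y < toIcoMod (one_pos : (0 : ℝ) < 1) x z := by
    rw [sbtw_iff_not_btw, btw_cyclic, ← not_le]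
    exact not_congr QuotientAddGroup.btw_coe_iff
  rw [h, hIoc, hIco]
  split_ifs <;> grind

theorem OrS1_coe {x y z : ℝ} (hx : x ∈ Set.Ico (0 : ℝ) 1) (hy : y ∈ Set.Ico (0 : ℝ) 1)
    (hz : z ∈ Set.Ico (0 : ℝ) 1) :
    OrS1 x y z = ((orderSign x y + orderSign y z + orderSign z x : ℤ) : ℝ) := by
  rw [OrS1, sbtw_coe_iff hx hy hz, sbtw_coe_iff hz hy hx]
  rcases lt_trichotomy x y with h₁ | h₁ | h₁ <;> rcases lt_trichotomy y z with h₂ | h₂ | h₂ <;>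
    rcases lt_trichotomy x z with h₃ | h₃ | h₃ <;>
    first
    | (exfalso; linarith)
    | simp [orderSign, *, h₁.not_gt, h₂.not_gt, h₃.not_gt]

theorem S1.exists_coe_eq (a : S1) : ∃ x ∈ Set.Ico (0 : ℝ) 1, (x : S1) = a :=
  ⟨AddCircle.equivIco 1 0 a, by simpa using (AddCircle.equivIco 1 0 a).2,
    AddCircle.coe_equivIco⟩

theorem OrS1_cocycle (o a b c : S1) : OrS1 a b c = OrS1 o a b + OrS1 o b c + OrS1 o c a := by
  obtain ⟨o, ho, rfl⟩ := S1.exists_coe_eq o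
  obtain ⟨a, ha, rfl⟩ := S1.exists_coe_eq a
  obtain ⟨b, hb, rfl⟩ := S1.exists_coe_eq b
  obtain ⟨c, hc, rfl⟩ := S1.exists_coe_eq c
  rw [OrS1_coe ha hb hc, OrS1_coe ho ha hb, OrS1_coe ho hb hc, OrS1_coe ho hc ha,
    orderSign_swap o a, orderSign_swap o b, orderSign_swap o c]
  push_cast
  ring

theorem OrS1_self_left (a b : S1) : OrS1 a a b = 0 ∧ OrS1 a b a = 0 := by
  obtain ⟨a, ha, rfl⟩ := S1.exists_coe_eq a
  obtain ⟨b, hb, rfl⟩ := S1.exists_coe_eq b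
  rw [OrS1_coe ha ha hb, OrS1_coe ha hb ha, orderSign_self, orderSign_swap a b]
  simp

theorem exists_perm_orderSign_eq {L : Type*} [LinearOrder L] {n : ℕ} {f : Fin n → L}
    (hf : Function.Injective f) :
    ∃ π : Equiv.Perm (Fin n), ∀ i j, orderSign (π i) (π j) = orderSign (f i) (f j) := by
  have hmono : StrictMono (f ∘ Tuple.sort f) :=
    (Tuple.monotone_sort f).strictMono_of_injective (hf.comp (Equiv.injective _))
  refine ⟨(Tuple.sort f)⁻¹, fun i j => ?_⟩
  have h (i j) : (Tuple.sort f)⁻¹ i < (Tuple.sort f)⁻¹ j ↔ f i < f j := by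
    rw [← hmono.lt_iff_lt]
    simp
  simp only [orderSign, h]

theorem OrS1_eq_average {n : ℕ} (o : S1) (x : Fin n → S1) :
    ∃ π ρ : Equiv.Perm (Fin n), ∀ i j, OrS1 o (x i) (x j) =
      ((orderSign (π i) (π j) : ℝ) + (orderSign (ρ i) (ρ j) : ℝ)) / 2 := by
  obtain ⟨o, ho, rfl⟩ := S1.exists_coe_eq o
  choose r hr hrx using fun i => S1.exists_coe_eq (x i)
  obtain ⟨π, hπ⟩ := exists_perm_orderSign_eq (n := n)
    (f := fun i => toLex (if r i < o then r i + 1 else r i, i))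
    fun i j h => (Prod.ext_iff.1 (toLex_inj.1 h)).2
  obtain ⟨ρ, hρ⟩ := exists_perm_orderSign_eq (n := n)
    (f := fun i => toLex (if r i ≤ o then r i + 1 else r i, OrderDual.toDual i))
    fun i j h => OrderDual.toDual_inj.1 (Prod.ext_iff.1 (toLex_inj.1 h)).2
  refine ⟨π, ρ, fun i j => ?_⟩
  rw [← hrx i, ← hrx j, OrS1_coe ho (hr i) (hr j), hπ, hρ]
  have hi := hr i
  have hj := hr j
  rw [eq_div_iff two_ne_zero]
  norm_cast
  simp only [orderSign, Prod.Lex.toLex_lt_toLex, OrderDual.toDual_lt_toDual]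
  generalize r i = a at *
  generalize r j = b at *
  obtain ⟨ha0, ha1⟩ := hi
  obtain ⟨hb0, hb1⟩ := hj
  obtain ⟨ho0, ho1⟩ := ho
  grind

theorem abs_altSum_orderSign_le (π₁ π₂ π₃ : Equiv.Perm (Fin 6)) :
    |altSum (id : Fin 6 → Fin 6) (fun y => (orderSign (π₁ (y 0)) (π₁ (y 1)) : ℝ) *
      ((orderSign (π₂ (y 2)) (π₂ (y 3)) : ℝ) * (orderSign (π₃ (y 4)) (π₃ (y 5)) : ℝ)))| ≤ 176 := by
  have hle (π₂ π₃ : Equiv.Perm (Fin 6)) :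
      altSum (id : Fin 6 → Fin 6) (fun y => (orderSign (y 0) (y 1) : ℝ) *
        ((orderSign (π₂ (y 2)) (π₂ (y 3)) : ℝ) * (orderSign (π₃ (y 4)) (π₃ (y 5)) : ℝ))) ≤ 176 := by
    have h := altSum_six (s := fun i j => orderSign (π₂ i) (π₂ j))
      (t := listSign (List.ofFn fun i => (π₃ i : ℕ))) (fun a b => orderSign_swap _ _)
      (fun a b => orderSign_swap _ _)
    have ht (i j : Fin 6) : listSign (List.ofFn fun i => (π₃ i : ℕ)) i j =
        orderSign (π₃ i) (π₃ j) := by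
      have hget (k : Fin 6) : (List.ofFn fun i => (π₃ i : ℕ)).getD k 0 = π₃ k := by
        rw [List.getD_eq_getElem _ _ (by simp), List.getElem_ofFn]
      simp only [listSign, hget, orderSign, Fin.val_fin_lt]
    simp only [ht] at h
    rw [h]
    exact_mod_cast (by linarith [sum_orderSign_mul_pairCoeff_le π₂ π₃] :
      4 * ∑ i, ∑ j, orderSign (π₂ i) (π₂ j) *
        pairCoeff (listSign (List.ofFn fun i => (π₃ i : ℕ))) i j ≤ 176)
  have hrev (i j : Fin 6) : orderSign (Fin.rev i) (Fin.rev j) = -orderSign i j := by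
    rw [← orderSign_swap]
    simp [orderSign]
  have habs (π₂ π₃ : Equiv.Perm (Fin 6)) :
      |altSum (id : Fin 6 → Fin 6) (fun y => (orderSign (y 0) (y 1) : ℝ) *
        ((orderSign (π₂ (y 2)) (π₂ (y 3)) : ℝ) *
          (orderSign (π₃ (y 4)) (π₃ (y 5)) : ℝ)))| ≤ 176 := by
    refine abs_le.2 ⟨?_, hle π₂ π₃⟩
    have h := hle (π₂.trans Fin.revPerm) π₃
    simp only [Equiv.trans_apply, Fin.revPerm_apply, hrev, Int.cast_neg, neg_mul, mul_neg,
      altSum_neg] at h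
    linarith
  have h := altSum_perm_comp (id : Fin 6 → Fin 6) π₁ fun y =>
    (orderSign (y 0) (y 1) : ℝ) * ((orderSign (π₂ (π₁.symm (y 2))) (π₂ (π₁.symm (y 3))) : ℝ) *
      (orderSign (π₃ (π₁.symm (y 4))) (π₃ (π₁.symm (y 5))) : ℝ))
  have h' := altSum_comp_left (id : Fin 6 → Fin 6) π₁ fun y =>
    (orderSign (y 0) (y 1) : ℝ) * ((orderSign (π₂ (π₁.symm (y 2))) (π₂ (π₁.symm (y 3))) : ℝ) *
      (orderSign (π₃ (π₁.symm (y 4))) (π₃ (π₁.symm (y 5))) : ℝ))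
  simp only [Function.comp_apply, Equiv.symm_apply_apply] at h'
  rw [h', Function.comp_id, ← Function.id_comp π₁, h, abs_mul]
  have hsign : |((Equiv.Perm.sign π₁ : ℤ) : ℝ)| = 1 := by
    rcases Int.units_eq_one_or (Equiv.Perm.sign π₁) with h | h <;> simp [h]
  rw [hsign, one_mul]
  exact habs (π₁.symm.trans π₂) (π₁.symm.trans π₃)

theorem abs_altSum_average_le (π ρ : Fin 3 → Equiv.Perm (Fin 6)) :
    |altSum (id : Fin 6 → Fin 6) (fun y =>
      (((orderSign (π 0 (y 0)) (π 0 (y 1)) : ℝ) + (orderSign (ρ 0 (y 0)) (ρ 0 (y 1)) : ℝ)) / 2) *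
      (((orderSign (π 1 (y 2)) (π 1 (y 3)) : ℝ) + (orderSign (ρ 1 (y 2)) (ρ 1 (y 3)) : ℝ)) / 2) *
      (((orderSign (π 2 (y 4)) (π 2 (y 5)) : ℝ) +
        (orderSign (ρ 2 (y 4)) (ρ 2 (y 5)) : ℝ)) / 2))| ≤ 176 := by
  set E : Equiv.Perm (Fin 6) → Equiv.Perm (Fin 6) → Equiv.Perm (Fin 6) → ℝ := fun π₁ π₂ π₃ =>
    altSum (id : Fin 6 → Fin 6) (fun y => (orderSign (π₁ (y 0)) (π₁ (y 1)) : ℝ) *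
      ((orderSign (π₂ (y 2)) (π₂ (y 3)) : ℝ) * (orderSign (π₃ (y 4)) (π₃ (y 5)) : ℝ))) with hE
  have hbound (π₁ π₂ π₃) := abs_le.1 (abs_altSum_orderSign_le π₁ π₂ π₃)
  have hsum : altSum (id : Fin 6 → Fin 6) (fun y =>
      (((orderSign (π 0 (y 0)) (π 0 (y 1)) : ℝ) + (orderSign (ρ 0 (y 0)) (ρ 0 (y 1)) : ℝ)) / 2) *
      (((orderSign (π 1 (y 2)) (π 1 (y 3)) : ℝ) + (orderSign (ρ 1 (y 2)) (ρ 1 (y 3)) : ℝ)) / 2) *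
      (((orderSign (π 2 (y 4)) (π 2 (y 5)) : ℝ) + (orderSign (ρ 2 (y 4)) (ρ 2 (y 5)) : ℝ)) / 2)) =
      1 / 8 * (E (π 0) (π 1) (π 2) + E (π 0) (π 1) (ρ 2) + E (π 0) (ρ 1) (π 2) +
        E (π 0) (ρ 1) (ρ 2) + E (ρ 0) (π 1) (π 2) + E (ρ 0) (π 1) (ρ 2) + E (ρ 0) (ρ 1) (π 2) +
        E (ρ 0) (ρ 1) (ρ 2)) := by
    simp only [hE, ← altSum_add, ← altSum_const_mul]
    congr 1
    funext y
    ring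
  rw [hsum, abs_le]
  constructor <;>
    linarith [hbound (π 0) (π 1) (π 2), hbound (π 0) (π 1) (ρ 2), hbound (π 0) (ρ 1) (π 2),
      hbound (π 0) (ρ 1) (ρ 2), hbound (ρ 0) (π 1) (π 2), hbound (ρ 0) (π 1) (ρ 2),
      hbound (ρ 0) (ρ 1) (π 2), hbound (ρ 0) (ρ 1) (ρ 2)]

/-- For every 7-tuple of points of `T³`, `|Θ(θ₀,…,θ₆)| ≤ 11/45`. -/
theorem abs_Theta_le (θ : Fin 7 → T3) : |Theta θ| ≤ 11 / 45 := by
  have hT : Theta θ = 1 / (Nat.factorial 7 : ℝ) * altSum θ (fun y =>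
      OrS1 (y 0).1 (y 1).1 (y 2).1 * OrS1 (y 2).2.1 (y 3).2.1 (y 4).2.1 *
        OrS1 (y 4).2.2 (y 5).2.2 (y 6).2.2) := rfl
  have hcocycle (y : Fin 7 → T3) :
      OrS1 (y 0).1 (y 1).1 (y 2).1 * OrS1 (y 2).2.1 (y 3).2.1 (y 4).2.1 *
        OrS1 (y 4).2.2 (y 5).2.2 (y 6).2.2 =
      (OrS1 (θ 0).1 (y 0).1 (y 1).1 + OrS1 (θ 0).1 (y 1).1 (y 2).1 +
        OrS1 (θ 0).1 (y 2).1 (y 0).1) *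
      (OrS1 (θ 0).2.1 (y 2).2.1 (y 3).2.1 + OrS1 (θ 0).2.1 (y 3).2.1 (y 4).2.1 +
        OrS1 (θ 0).2.1 (y 4).2.1 (y 2).2.1) *
      (OrS1 (θ 0).2.2 (y 4).2.2 (y 5).2.2 + OrS1 (θ 0).2.2 (y 5).2.2 (y 6).2.2 +
        OrS1 (θ 0).2.2 (y 6).2.2 (y 4).2.2) := by
    rw [OrS1_cocycle (θ 0).1 (y 0).1, OrS1_cocycle (θ 0).2.1 (y 2).2.1,
      OrS1_cocycle (θ 0).2.2 (y 4).2.2]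
  rw [funext hcocycle, altSum_cocycle_mul θ (fun a b => OrS1 (θ 0).1 a.1 b.1)
    (fun a b => OrS1 (θ 0).2.1 a.2.1 b.2.1) (fun a b => OrS1 (θ 0).2.2 a.2.2 b.2.2),
    altSum_eq_tail θ (s₁ := fun a b => OrS1 (θ 0).1 a.1 b.1)
      (s₂ := fun a b => OrS1 (θ 0).2.1 a.2.1 b.2.1) (s₃ := fun a b => OrS1 (θ 0).2.2 a.2.2 b.2.2)
      (fun a => OrS1_self_left _ _) (fun a => OrS1_self_left _ _)
      (fun a => OrS1_self_left _ _)] at hT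
  obtain ⟨π₁, ρ₁, h₁⟩ := OrS1_eq_average (θ 0).1 fun i => (Fin.tail θ i).1
  obtain ⟨π₂, ρ₂, h₂⟩ := OrS1_eq_average (θ 0).2.1 fun i => (Fin.tail θ i).2.1
  obtain ⟨π₃, ρ₃, h₃⟩ := OrS1_eq_average (θ 0).2.2 fun i => (Fin.tail θ i).2.2
  have hid := altSum_comp_left (id : Fin 6 → Fin 6) (Fin.tail θ) fun y =>
    OrS1 (θ 0).1 (y 0).1 (y 1).1 * OrS1 (θ 0).2.1 (y 2).2.1 (y 3).2.1 *
      OrS1 (θ 0).2.2 (y 4).2.2 (y 5).2.2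
  simp only [Function.comp_apply, h₁, h₂, h₃] at hid
  rw [Function.comp_id] at hid
  have hle := abs_altSum_average_le ![π₁, π₂, π₃] ![ρ₁, ρ₂, ρ₃]
  simp only [Matrix.cons_val] at hle
  rw [hid, abs_le] at hle
  rw [hT, abs_le]
  norm_num [Nat.factorial] at hle ⊢
  constructor <;> linarith [hle.1, hle.2]
end
end

section
/- For all points xⱼ, yⱼ, zⱼ ∈ S¹ (j = 0,…,6), one has Θ((x₀,y₀,z₀),…,(x₆,y₆,z₆)) = Θ((y₀,x₀,z₀),…,(y₆,x₆,z₆)) and Θ((x₀,y₀,z₀),…,(x₆,y₆,z₆)) = Θ((x₀,z₀,y₀),…,(x₆,z₆,y₆)); that is, Θ is invariant under simultaneously permuting the three circle factors of T³ in all seven arguments. -/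
open scoped BigOperators
open scoped Classical

noncomputable section

theorem OrS1_rotate (a b c : S1) : OrS1 b c a = OrS1 a b c := by
  have h₁ : sbtw b c a ↔ sbtw a b c := sbtw_cyclic
  have h₂ : sbtw a c b ↔ sbtw c b a := sbtw_cyclic.symm
  simp only [OrS1, h₁, h₂]

theorem OrS1_reverse (a b c : S1) : OrS1 c b a = -OrS1 a b c := by
  have h : sbtw a b c → ¬ sbtw c b a := fun h => h.not_sbtw
  unfold OrS1
  split_ifs <;> first | simp | (exfalso; tauto)

theorem sbtw_or_sbtw_of_ne {a b c : S1} (hab : a ≠ b) (hbc : b ≠ c) (hca : c ≠ a) :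
    sbtw a b c ∨ sbtw c b a := by
  by_contra! h
  rw [sbtw_iff_not_btw, sbtw_iff_not_btw, not_not, not_not] at h
  rcases h.2.antisymm h.1 with h | h | h <;> tauto

/-- A function of three variables that is alternating and satisfies the cocycle identity. -/
structure IsAlternatingCocycle {α : Type*} (f : α → α → α → ℝ) : Prop where
  rotate : ∀ a b c, f b c a = f a b c
  reverse : ∀ a b c, f c b a = -f a b c
  cocycle : ∀ a b c d, f b c d - f a c d + f a b d - f a b c = 0

theorem isAlternatingCocycle_OrS1 : IsAlternatingCocycle OrS1 where
  rotate := OrS1_rotate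
  reverse := OrS1_reverse
  cocycle a b c d := by
    have rot := OrS1_rotate
    have rev := OrS1_reverse
    by_cases hdeg : a = b ∨ b = c ∨ c = d ∨ a = c ∨ b = d ∨ a = d
    · grind
    push Not at hdeg
    obtain ⟨hab, hbc, hcd, hac, hbd, had⟩ := hdeg
    have chain : ∀ {p q r s : S1}, sbtw p q r → sbtw p r s → sbtw p q s ∧ sbtw q r s :=
      fun h h' => ⟨h.trans_right h', (h'.cyclic_left.trans_right h.cyclic_right).cyclic_right⟩
    have one : ∀ {p q r : S1}, sbtw p q r → OrS1 p q r = 1 := fun h => if_pos h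
    rcases sbtw_or_sbtw_of_ne hab hbc (Ne.symm hac) with h₁ | h₁ <;>
    rcases sbtw_or_sbtw_of_ne hac hcd (Ne.symm had) with h₂ | h₂ <;>
    rcases sbtw_or_sbtw_of_ne hab hbd (Ne.symm had) with h₃ | h₃ <;>
    grind [SBtw.sbtw.cyclic_left, SBtw.sbtw.not_sbtw]

theorem IsAlternatingCocycle.swap_right {α : Type*} {f : α → α → α → ℝ}
    (hf : IsAlternatingCocycle f) (a b c : α) : f a c b = -f a b c := by
  rw [← hf.reverse, ← hf.rotate]

theorem IsAlternatingCocycle.comp {α β : Type*} {f : α → α → α → ℝ}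
    (hf : IsAlternatingCocycle f) (g : β → α) :
    IsAlternatingCocycle fun a b c => f (g a) (g b) (g c) where
  rotate _ _ _ := hf.rotate _ _ _
  reverse _ _ _ := hf.reverse _ _ _
  cocycle _ _ _ _ := hf.cocycle _ _ _ _

/-- The signed sum of a function over all permutations. -/
def signedSum {ι : Type*} [Fintype ι] [DecidableEq ι] (F : Equiv.Perm ι → ℝ) : ℝ :=
  ∑ σ : Equiv.Perm ι, ((Equiv.Perm.sign σ : ℤ) : ℝ) * F σ

section signedSum

variable {ι : Type*} [Fintype ι] [DecidableEq ι]

theorem signedSum_mul_right (F : Equiv.Perm ι → ℝ) (τ : Equiv.Perm ι) :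
    signedSum (fun σ => F (σ * τ)) = ((Equiv.Perm.sign τ : ℤ) : ℝ) * signedSum F := by
  unfold signedSum
  rw [← Equiv.sum_comp (Equiv.mulRight τ) (fun σ => ((Equiv.Perm.sign σ : ℤ) : ℝ) * F σ),
    Finset.mul_sum]
  refine Finset.sum_congr rfl fun σ _ => ?_
  rcases Int.units_eq_one_or (Equiv.Perm.sign τ) with h | h <;> simp [h]

theorem signedSum_swap {i j : ι} (hij : i ≠ j) (F : Equiv.Perm ι → ℝ) :
    signedSum (fun σ => F (σ * Equiv.swap i j)) = -signedSum F := by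
  rw [signedSum_mul_right, Equiv.Perm.sign_swap hij]
  simp

theorem signedSum_eq_zero_of_swap {i j : ι} (hij : i ≠ j) (F : Equiv.Perm ι → ℝ)
    (hF : ∀ σ, F (σ * Equiv.swap i j) = F σ) : signedSum F = 0 := by
  have h := signedSum_swap hij F
  simp only [hF] at h
  linarith

theorem signedSum_add (F G : Equiv.Perm ι → ℝ) :
    signedSum (fun σ => F σ + G σ) = signedSum F + signedSum G := by
  simp only [signedSum, mul_add, Finset.sum_add_distrib]

theorem signedSum_sub (F G : Equiv.Perm ι → ℝ) :
    signedSum (fun σ => F σ - G σ) = signedSum F - signedSum G := by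
  simp only [signedSum, mul_sub, Finset.sum_sub_distrib]

end signedSum

section sevenPoints

variable {X Y Z : Fin 7 → Fin 7 → Fin 7 → ℝ}

/-- If `X` and `Y` share two points, one of which also lies on `Z`, the signed sum vanishes. -/
theorem signedSum_shared_pair (hX : IsAlternatingCocycle X) (hY : IsAlternatingCocycle Y)
    (hZ : IsAlternatingCocycle Z) :
    signedSum (fun σ : Equiv.Perm (Fin 7) =>
      X (σ 1) (σ 2) (σ 4) * Y (σ 2) (σ 3) (σ 4) * Z (σ 4) (σ 5) (σ 6)) = 0 := by
  set F : Equiv.Perm (Fin 7) → ℝ := fun σ =>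
    X (σ 1) (σ 2) (σ 4) * Y (σ 2) (σ 3) (σ 4) * Z (σ 4) (σ 5) (σ 6) with hF
  have h₅ := signedSum_swap (show (0 : Fin 7) ≠ 5 by decide) F
  have h₆ := signedSum_swap (show (0 : Fin 7) ≠ 6 by decide) F
  have h₀ : signedSum (fun σ : Equiv.Perm (Fin 7) =>
      X (σ 1) (σ 2) (σ 4) * Y (σ 2) (σ 3) (σ 4) * Z (σ 5) (σ 6) (σ 0)) = 0 := by
    apply signedSum_eq_zero_of_swap (show (2 : Fin 7) ≠ 4 by decide)
    intro σ
    simp only [Equiv.Perm.mul_apply, Equiv.swap_apply_def, Fin.reduceEq, if_true, if_false]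
    rw [hY.reverse, hX.swap_right (σ 1) (σ 2) (σ 4)]
    ring
  have hsum : (fun σ => F σ - F (σ * Equiv.swap 0 5) - F (σ * Equiv.swap 0 6)) =
      fun σ => X (σ 1) (σ 2) (σ 4) * Y (σ 2) (σ 3) (σ 4) * Z (σ 5) (σ 6) (σ 0) := by
    funext σ
    simp only [hF, Equiv.Perm.mul_apply, Equiv.swap_apply_def, Fin.reduceEq, if_true, if_false]
    rw [hZ.swap_right (σ 4) (σ 6) (σ 0)]
    linear_combination -(X (σ 1) (σ 2) (σ 4) * Y (σ 2) (σ 3) (σ 4)) *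
      hZ.cocycle (σ 4) (σ 5) (σ 6) (σ 0)
  rw [← hsum, signedSum_sub, signedSum_sub, h₅, h₆] at h₀
  linarith

/-- The signed sum of a chain of three triangles equals the signed sum of three triangles with a
common vertex. -/
theorem signedSum_chain_eq_star (hX : IsAlternatingCocycle X) (hY : IsAlternatingCocycle Y)
    (hZ : IsAlternatingCocycle Z) :
    signedSum (fun σ : Equiv.Perm (Fin 7) =>
      X (σ 0) (σ 1) (σ 2) * Y (σ 2) (σ 3) (σ 4) * Z (σ 4) (σ 5) (σ 6)) =
    signedSum (fun σ : Equiv.Perm (Fin 7) =>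
      X (σ 0) (σ 1) (σ 4) * Y (σ 2) (σ 3) (σ 4) * Z (σ 4) (σ 5) (σ 6)) := by
  have h := signedSum_shared_pair hX hY hZ
  have h' := signedSum_swap (show (0 : Fin 7) ≠ 1 by decide) (fun σ : Equiv.Perm (Fin 7) =>
      X (σ 1) (σ 2) (σ 4) * Y (σ 2) (σ 3) (σ 4) * Z (σ 4) (σ 5) (σ 6))
  simp only [Equiv.Perm.mul_apply, Equiv.swap_apply_def, Fin.reduceEq, if_true, if_false] at h'
  have hsum : (fun σ : Equiv.Perm (Fin 7) =>
      X (σ 0) (σ 1) (σ 2) * Y (σ 2) (σ 3) (σ 4) * Z (σ 4) (σ 5) (σ 6)) =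
      fun σ => X (σ 0) (σ 1) (σ 4) * Y (σ 2) (σ 3) (σ 4) * Z (σ 4) (σ 5) (σ 6) +
        X (σ 1) (σ 2) (σ 4) * Y (σ 2) (σ 3) (σ 4) * Z (σ 4) (σ 5) (σ 6) -
        X (σ 0) (σ 2) (σ 4) * Y (σ 2) (σ 3) (σ 4) * Z (σ 4) (σ 5) (σ 6) := by
    funext σ
    linear_combination -(Y (σ 2) (σ 3) (σ 4) * Z (σ 4) (σ 5) (σ 6)) *
      hX.cocycle (σ 0) (σ 1) (σ 2) (σ 4)
  rw [hsum, signedSum_sub, signedSum_add, h', h]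
  ring

theorem signedSum_chain_swap_left (hX : IsAlternatingCocycle X) (hY : IsAlternatingCocycle Y)
    (hZ : IsAlternatingCocycle Z) :
    signedSum (fun σ : Equiv.Perm (Fin 7) =>
      Y (σ 0) (σ 1) (σ 2) * X (σ 2) (σ 3) (σ 4) * Z (σ 4) (σ 5) (σ 6)) =
    signedSum (fun σ : Equiv.Perm (Fin 7) =>
      X (σ 0) (σ 1) (σ 2) * Y (σ 2) (σ 3) (σ 4) * Z (σ 4) (σ 5) (σ 6)) := by
  rw [signedSum_chain_eq_star hX hY hZ, signedSum_chain_eq_star hY hX hZ]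
  have h := signedSum_mul_right (fun σ : Equiv.Perm (Fin 7) =>
      X (σ 0) (σ 1) (σ 4) * Y (σ 2) (σ 3) (σ 4) * Z (σ 4) (σ 5) (σ 6))
    (Equiv.swap 0 2 * Equiv.swap 1 3)
  simp only [Equiv.Perm.mul_apply, Equiv.swap_apply_def, Fin.reduceEq, if_true, if_false,
    Equiv.Perm.sign_mul, Equiv.Perm.sign_swap', mul_neg, neg_neg, mul_one, Units.val_one,
    Int.cast_one, one_mul] at h
  rw [← h]
  congr 1
  funext σ
  ring

theorem signedSum_chain_swap_right (hX : IsAlternatingCocycle X) (hY : IsAlternatingCocycle Y)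
    (hZ : IsAlternatingCocycle Z) :
    signedSum (fun σ : Equiv.Perm (Fin 7) =>
      X (σ 0) (σ 1) (σ 2) * Z (σ 2) (σ 3) (σ 4) * Y (σ 4) (σ 5) (σ 6)) =
    signedSum (fun σ : Equiv.Perm (Fin 7) =>
      X (σ 0) (σ 1) (σ 2) * Y (σ 2) (σ 3) (σ 4) * Z (σ 4) (σ 5) (σ 6)) := by
  rw [signedSum_chain_eq_star hX hY hZ, signedSum_chain_eq_star hX hZ hY]
  have h := signedSum_mul_right (fun σ : Equiv.Perm (Fin 7) =>
      X (σ 0) (σ 1) (σ 4) * Y (σ 2) (σ 3) (σ 4) * Z (σ 4) (σ 5) (σ 6))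
    (Equiv.swap 2 5 * Equiv.swap 3 6)
  simp only [Equiv.Perm.mul_apply, Equiv.swap_apply_def, Fin.reduceEq, if_true, if_false,
    Equiv.Perm.sign_mul, Equiv.Perm.sign_swap', mul_neg, neg_neg, mul_one, Units.val_one,
    Int.cast_one, one_mul] at h
  rw [← h]
  congr 1
  funext σ
  rw [hY.rotate (σ 4) (σ 5) (σ 6), ← hZ.rotate (σ 4) (σ 2) (σ 3)]
  ring

end sevenPoints

theorem Theta_eq_signedSum (x y z : Fin 7 → S1) :
    Theta (fun j => (x j, y j, z j)) = (1 / (Nat.factorial 7 : ℝ)) *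
      signedSum (fun σ : Equiv.Perm (Fin 7) =>
        OrS1 (x (σ 0)) (x (σ 1)) (x (σ 2)) * OrS1 (y (σ 2)) (y (σ 3)) (y (σ 4)) *
          OrS1 (z (σ 4)) (z (σ 5)) (z (σ 6))) := by
  rfl

/-- `Θ` is invariant under simultaneously permuting the three circle factors of `T³`
in all seven arguments: swapping the first two factors or the last two factors leaves
`Θ` unchanged. -/
theorem Theta_swap_factors (x y z : Fin 7 → S1) :
    Theta (fun j => (y j, x j, z j)) = Theta (fun j => (x j, y j, z j)) ∧
    Theta (fun j => (x j, z j, y j)) = Theta (fun j => (x j, y j, z j)) := by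
  have hX := isAlternatingCocycle_OrS1.comp x
  have hY := isAlternatingCocycle_OrS1.comp y
  have hZ := isAlternatingCocycle_OrS1.comp z
  simp only [Theta_eq_signedSum]
  exact ⟨congrArg _ (signedSum_chain_swap_left hX hY hZ),
    congrArg _ (signedSum_chain_swap_right hX hY hZ)⟩
end
end
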